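/- arXiv:2503.19845 — 11 statements merged into one kernel-verified Lean document; each statement's English description precedes it below -/
import Mathlib

section
/- Let (X,Y) be a Lagrangian frame of size m, i.e., X, Y are m×m complex matrices with XᴴY = YᴴX and the 2m×m block column matrix [X;Y] has rank m. Then both X − iY and X + iY are invertible m×m matrices. -/
open Matrix

/-- A square matrix over a field whose rank equals its size is invertible. -/
theorem Matrix.isUnit_of_rank_eq_card {n K : Type*} [Fintype n] [DecidableEq n] [Field K]
    {A : Matrix n n K} (h : A.rank = Fintype.card n) : IsUnit A := by
  rw [← Matrix.mulVec_surjective_iff_isUnit]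
  have htop : LinearMap.range A.mulVecLin = ⊤ :=
    Submodule.eq_top_of_finrank_eq (by rw [Module.finrank_fintype_fun_eq_card]; exact h)
  exact LinearMap.range_eq_top.mp htop

/-- A square matrix with the same Gram matrix as a matrix of full column rank is invertible. -/
theorem Matrix.isUnit_of_conjTranspose_mul_self_eq {k n K : Type*} [Fintype k] [Fintype n]
    [DecidableEq n] [Field K] [PartialOrder K] [StarRing K] [StarOrderedRing K]
    {A : Matrix n n K} {F : Matrix k n K} (h : Aᴴ * A = Fᴴ * F)
    (hF : F.rank = Fintype.card n) : IsUnit A := by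
  apply Matrix.isUnit_of_rank_eq_card
  rw [← Matrix.rank_conjTranspose_mul_self, h, Matrix.rank_conjTranspose_mul_self, hF]

/-- If `(X, Y)` is a Lagrangian frame of size `m`, i.e. `Xᴴ * Y = Yᴴ * X`
and the block column matrix `[X; Y]` has rank `m`, then both `X - i•Y` and `X + i•Y`
are invertible. -/
theorem lagrangian_frame_invertible (m : ℕ) (X Y : Matrix (Fin m) (Fin m) ℂ)
    (hsym : Xᴴ * Y = Yᴴ * X)
    (hrank : (Matrix.fromRows X Y).rank = m) :
    IsUnit (X - Complex.I • Y) ∧ IsUnit (X + Complex.I • Y) := by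
  have hF : (Matrix.fromRows X Y)ᴴ * Matrix.fromRows X Y = Xᴴ * X + Yᴴ * Y := by
    rw [Matrix.conjTranspose_fromRows_eq_fromCols_conjTranspose, Matrix.fromCols_mul_fromRows]
  have hcard : (Matrix.fromRows X Y).rank = Fintype.card (Fin m) := by simpa using hrank
  open scoped ComplexOrder in
  constructor <;> refine Matrix.isUnit_of_conjTranspose_mul_self_eq ?_ hcard <;> rw [hF]
  · simp [add_mul, mul_sub, hsym, smul_smul, smul_add]
    abel
  · simp [sub_mul, ← sub_eq_add_neg, mul_add, hsym, smul_smul, smul_sub]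
    abel
end

section
/- Let (X,Y) be a Lagrangian frame of size m, i.e., X, Y are m×m complex matrices with XᴴY = YᴴX and the 2m×m block column matrix [X;Y] has rank m, and let W := (X+iY)(X−iY)⁻¹. Then XᴴX + YᴴY is invertible, W = (X+iY)·(XᴴX+YᴴY)⁻¹·(Xᴴ+iYᴴ), and det W = det(X+iY)·det(Xᴴ+iYᴴ)·det(XᴴX+YᴴY)⁻¹. -/
open Matrix

open scoped ComplexOrder in
/-- The Gram matrix of a full-rank frame is a unit. -/
theorem Matrix.isUnit_conjTranspose_mul_self_add {m : ℕ} {X Y : Matrix (Fin m) (Fin m) ℂ}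
    (hrank : (Matrix.fromRows X Y).rank = m) : IsUnit (Xᴴ * X + Yᴴ * Y) := by
  have h : (Matrix.fromRows X Y)ᴴ * Matrix.fromRows X Y = Xᴴ * X + Yᴴ * Y := by
    rw [Matrix.conjTranspose_fromRows_eq_fromCols_conjTranspose, Matrix.fromCols_mul_fromRows]
  apply Matrix.isUnit_of_rank_eq_card
  rw [← h, Matrix.rank_conjTranspose_mul_self, hrank, Fintype.card_fin]

/-- For a symmetric frame the Gram matrix factors through `X - iY`. -/
theorem Matrix.conjTranspose_add_mul_sub {m : ℕ} {X Y : Matrix (Fin m) (Fin m) ℂ}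
    (hsym : Xᴴ * Y = Yᴴ * X) :
    (Xᴴ + Complex.I • Yᴴ) * (X - Complex.I • Y) = Xᴴ * X + Yᴴ * Y := by
  simp only [add_mul, mul_sub, Matrix.smul_mul, Matrix.mul_smul, smul_smul, Complex.I_mul_I, hsym]
  module

/-- For a Lagrangian frame `(X, Y)` of size `m` with associated unitary
`W = (X + iY)(X - iY)⁻¹`, the matrix `XᴴX + YᴴY` is invertible,
`W = (X + iY) (XᴴX + YᴴY)⁻¹ (Xᴴ + iYᴴ)`, and
`det W = det (X + iY) · det (Xᴴ + iYᴴ) · (det (XᴴX + YᴴY))⁻¹`. -/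
theorem lagrangian_frame_W_formula (m : ℕ) (X Y : Matrix (Fin m) (Fin m) ℂ)
    (hsym : Xᴴ * Y = Yᴴ * X)
    (hrank : (Matrix.fromRows X Y).rank = m)
    (W : Matrix (Fin m) (Fin m) ℂ)
    (hW : W = (X + Complex.I • Y) * (X - Complex.I • Y)⁻¹) :
    IsUnit (Xᴴ * X + Yᴴ * Y) ∧
    W = (X + Complex.I • Y) * (Xᴴ * X + Yᴴ * Y)⁻¹ * (Xᴴ + Complex.I • Yᴴ) ∧
    W.det = (X + Complex.I • Y).det * (Xᴴ + Complex.I • Yᴴ).det * ((Xᴴ * X + Yᴴ * Y).det)⁻¹ := by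
  have hG := Matrix.isUnit_conjTranspose_mul_self_add hrank
  have hfac := Matrix.conjTranspose_add_mul_sub hsym
  have hdet : IsUnit (Xᴴ + Complex.I • Yᴴ).det := by
    have h := (Matrix.isUnit_iff_isUnit_det _).mp hG
    rw [← hfac, Matrix.det_mul] at h
    exact isUnit_of_mul_isUnit_left h
  have hformula : W = (X + Complex.I • Y) * (Xᴴ * X + Yᴴ * Y)⁻¹ * (Xᴴ + Complex.I • Yᴴ) := by
    rw [hW, ← hfac, Matrix.mul_inv_rev, mul_assoc, mul_assoc, Matrix.nonsing_inv_mul _ hdet, mul_one]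
  refine ⟨hG, hformula, ?_⟩
  rw [hformula, Matrix.det_mul, Matrix.det_mul, Matrix.det_nonsing_inv, Ring.inverse_eq_inv']
  ring
end

section
/- Let Å ∈ GL(2m,ℂ) satisfy ÅᴴηÅ = η, where η = [[I_m, 0],[0, −I_m]], and write Å in m×m blocks as Å = [[A₁, A₂],[A₃, A₄]]. Then for every unitary W ∈ U(m), the matrix A₁ + A₂W is invertible and (A₃ + A₄W)(A₁ + A₂W)⁻¹ is again unitary. -/
open Matrix

/-- If `Å = [[A₁, A₂],[A₃, A₄]] ∈ GL(2m, ℂ)` satisfies `Åᴴ η Å = η` with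
`η = [[I, 0],[0, -I]]`, then for every unitary `W`, the matrix `A₁ + A₂ W` is invertible and
`(A₃ + A₄ W)(A₁ + A₂ W)⁻¹` is again unitary. -/
theorem pseudo_unitary_moebius_action (m : ℕ)
    (A₁ A₂ A₃ A₄ : Matrix (Fin m) (Fin m) ℂ)
    (hunit : IsUnit (Matrix.fromBlocks A₁ A₂ A₃ A₄))
    (hpseudo : (Matrix.fromBlocks A₁ A₂ A₃ A₄)ᴴ *
        (Matrix.fromBlocks 1 0 0 (-1) : Matrix (Fin m ⊕ Fin m) (Fin m ⊕ Fin m) ℂ) *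
        Matrix.fromBlocks A₁ A₂ A₃ A₄ =
      Matrix.fromBlocks 1 0 0 (-1)) :
    ∀ W : Matrix (Fin m) (Fin m) ℂ, Wᴴ * W = 1 →
      IsUnit (A₁ + A₂ * W) ∧
      ((A₃ + A₄ * W) * (A₁ + A₂ * W)⁻¹)ᴴ * ((A₃ + A₄ * W) * (A₁ + A₂ * W)⁻¹) = 1 := by
  intro W hW
  simp only [fromBlocks_conjTranspose, fromBlocks_multiply, fromBlocks_inj, mul_zero, zero_add,
    add_zero, mul_one, mul_neg, neg_mul] at hpseudo
  obtain ⟨h11, h12, h21, h22⟩ := hpseudo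
  rw [← sub_eq_add_neg] at h11 h12 h21 h22
  have hcol₁ : A₁ᴴ * (A₁ + A₂ * W) - A₃ᴴ * (A₃ + A₄ * W) = 1 := by
    calc _ = (A₁ᴴ * A₁ - A₃ᴴ * A₃) + (A₁ᴴ * A₂ - A₃ᴴ * A₄) * W := by noncomm_ring
      _ = 1 := by rw [h11, h12, zero_mul, add_zero]
  have hcol₂ : A₂ᴴ * (A₁ + A₂ * W) - A₄ᴴ * (A₃ + A₄ * W) = -W := by
    calc _ = (A₂ᴴ * A₁ - A₄ᴴ * A₃) + (A₂ᴴ * A₂ - A₄ᴴ * A₄) * W := by noncomm_ring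
      _ = -W := by rw [h21, h22, zero_add, neg_one_mul]
  have hgram : (A₁ + A₂ * W)ᴴ * (A₁ + A₂ * W) = (A₃ + A₄ * W)ᴴ * (A₃ + A₄ * W) := by
    rw [← sub_eq_zero]
    calc _ = (A₁ᴴ * (A₁ + A₂ * W) - A₃ᴴ * (A₃ + A₄ * W)) +
          Wᴴ * (A₂ᴴ * (A₁ + A₂ * W) - A₄ᴴ * (A₃ + A₄ * W)) := by
            simp only [conjTranspose_add, conjTranspose_mul]
            noncomm_ring
      _ = 0 := by rw [hcol₁, hcol₂, mul_neg, hW, add_neg_cancel]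
  have hX : IsUnit (A₁ + A₂ * W) := by
    rw [← mulVec_injective_iff_isUnit, ← coe_mulVecLin, injective_iff_map_eq_zero]
    intro v hv
    rw [mulVecLin_apply] at hv
    have hYv : (A₃ + A₄ * W) *ᵥ v = 0 := by
      open scoped ComplexOrder in
      rwa [← conjTranspose_mul_self_mulVec_eq_zero, ← hgram,
        conjTranspose_mul_self_mulVec_eq_zero]
    rw [← one_mulVec v, ← hcol₁, sub_mulVec, ← mulVec_mulVec, ← mulVec_mulVec, hv, hYv,
      mulVec_zero, mulVec_zero, sub_zero]
  refine ⟨hX, ?_⟩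
  have hdet := (isUnit_iff_isUnit_det _).mp hX
  rw [conjTranspose_mul, mul_assoc, ← mul_assoc (A₃ + A₄ * W)ᴴ, ← hgram, mul_assoc,
    mul_nonsing_inv _ hdet, mul_one, ← conjTranspose_mul, mul_nonsing_inv _ hdet,
    conjTranspose_one]
end

section
/- Let A ∈ GL(2m,ℂ) satisfy AᴴJA = J (A Hermitian symplectic), let (X,Y) be a Lagrangian frame of size m with associated unitary W = (X+iY)(X−iY)⁻¹, and define [X₁;Y₁] := A·[X;Y] (block multiplication of the 2m×2m matrix A with the 2m×m matrix [X;Y]). Write the Cayley conjugate Å := 𝒞A𝒞⁻¹ in m×m blocks as [[A₁, A₂],[A₃, A₄]], where 𝒞 = (1+i)⁻¹·[[I_m, −i·I_m],[I_m, i·I_m]]. Then (X₁,Y₁) is again a Lagrangian frame, A₁ + A₂W is invertible, and (X₁+iY₁)(X₁−iY₁)⁻¹ = (A₃ + A₄W)(A₁ + A₂W)⁻¹. -/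
open Matrix

section LagrangianFrames

variable {n : Type*} [Fintype n] [DecidableEq n]

lemma conjTranspose_fromRows_mul_J_mul_fromRows (X Y : Matrix n n ℂ) :
    (fromRows X Y)ᴴ * (fromBlocks 0 1 (-1) 0 : Matrix (n ⊕ n) (n ⊕ n) ℂ) * fromRows X Y =
      Xᴴ * Y - Yᴴ * X := by
  rw [conjTranspose_fromRows_eq_fromCols_conjTranspose, fromCols_mul_fromBlocks,
    fromCols_mul_fromRows]
  simp [sub_eq_neg_add]

open scoped ComplexOrder in
lemma isUnit_sub_I_smul_of_rank_fromRows {X Y : Matrix n n ℂ} (hsym : Xᴴ * Y = Yᴴ * X)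
    (hrank : (fromRows X Y).rank = Fintype.card n) : IsUnit (X - Complex.I • Y) := by
  have hgram : (X - Complex.I • Y)ᴴ * (X - Complex.I • Y) =
      (fromRows X Y)ᴴ * fromRows X Y := by
    rw [conjTranspose_fromRows_eq_fromCols_conjTranspose, fromCols_mul_fromRows]
    simp [mul_sub, add_mul, smul_smul, hsym]
    abel
  have hrank' : (X - Complex.I • Y).rank = Fintype.card n := by
    rw [← rank_conjTranspose_mul_self, hgram, rank_conjTranspose_mul_self, hrank]
  rw [← mulVec_surjective_iff_isUnit, ← coe_mulVecLin, ← LinearMap.range_eq_top]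
  exact Submodule.eq_top_of_finrank_eq (hrank'.trans (Module.finrank_fintype_fun_eq_card ℂ).symm)

lemma isUnit_fromBlocks_cayley :
    IsUnit ((1 + Complex.I)⁻¹ •
      (fromBlocks 1 (-(Complex.I • 1)) 1 (Complex.I • 1) : Matrix (n ⊕ n) (n ⊕ n) ℂ)) := by
  have hne : (1 + Complex.I) ≠ 0 := fun h => by simpa using congrArg Complex.re h
  refine IsUnit.of_mul_eq_one (((1 + Complex.I) / 2) •
    fromBlocks 1 1 (Complex.I • 1) (-(Complex.I • 1))) ?_
  rw [smul_mul_smul_comm, fromBlocks_multiply]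
  simp only [mul_one, mul_neg, neg_mul, smul_mul_smul_comm, Complex.I_mul_I, neg_smul, one_smul,
    neg_neg, add_neg_cancel]
  rw [← fromBlocks_one, fromBlocks_smul, ← two_smul ℂ (1 : Matrix n n ℂ), smul_smul]
  have hc : (1 + Complex.I)⁻¹ * ((1 + Complex.I) / 2) * 2 = 1 := by field_simp
  simp [hc]

lemma fromBlocks_cayley_mul_fromRows (X Y : Matrix n n ℂ) :
    (fromBlocks 1 (-(Complex.I • 1)) 1 (Complex.I • 1) : Matrix (n ⊕ n) (n ⊕ n) ℂ) *
      fromRows X Y = fromRows (X - Complex.I • Y) (X + Complex.I • Y) := by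
  rw [fromBlocks_mul_fromRows]
  simp [sub_eq_add_neg]

/-- The Cayley conjugate of `A` acts on the pairs `(X - iY, X + iY)` as `A` acts on `(X, Y)`. -/
lemma cayley_conj_mul_fromRows {C : Matrix (n ⊕ n) (n ⊕ n) ℂ}
    (hC : C = (1 + Complex.I)⁻¹ • fromBlocks 1 (-(Complex.I • (1 : Matrix n n ℂ))) 1
      (Complex.I • 1)) (A : Matrix (n ⊕ n) (n ⊕ n) ℂ) {X Y X₁ Y₁ : Matrix n n ℂ}
    (hA : A * fromRows X Y = fromRows X₁ Y₁) :
    C * A * C⁻¹ * fromRows (X - Complex.I • Y) (X + Complex.I • Y) =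
      fromRows (X₁ - Complex.I • Y₁) (X₁ + Complex.I • Y₁) := by
  have hdet : IsUnit C.det := by
    rw [← isUnit_iff_isUnit_det, hC]
    exact isUnit_fromBlocks_cayley
  have hCmul (U V : Matrix n n ℂ) : C * fromRows U V =
      (1 + Complex.I)⁻¹ • fromRows (U - Complex.I • V) (U + Complex.I • V) := by
    rw [hC, Matrix.smul_mul, fromBlocks_cayley_mul_fromRows]
  have hne : (1 + Complex.I)⁻¹ ≠ 0 :=
    inv_ne_zero fun h => by simpa using congrArg Complex.re h
  apply smul_right_injective _ hne
  simp only
  rw [← Matrix.mul_smul, ← hCmul, ← hCmul, Matrix.mul_assoc, nonsing_inv_mul_cancel_left _ _ hdet,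
    Matrix.mul_assoc, hA]

end LagrangianFrames

/-- Let `A` be Hermitian symplectic (`Aᴴ J A = J`), let `(X, Y)` be a
Lagrangian frame with associated unitary `W = (X+iY)(X−iY)⁻¹`, and `[X₁; Y₁] := A·[X; Y]`.
Write the Cayley conjugate `Å = 𝒞 A 𝒞⁻¹` in blocks `[[A₁, A₂],[A₃, A₄]]`. Then `(X₁, Y₁)` is
again a Lagrangian frame, `A₁ + A₂ W` is invertible, and
`(X₁+iY₁)(X₁−iY₁)⁻¹ = (A₃ + A₄ W)(A₁ + A₂ W)⁻¹`. -/
theorem cayley_blocks_moebius_formula (m : ℕ)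
    (A : Matrix (Fin m ⊕ Fin m) (Fin m ⊕ Fin m) ℂ)
    (hAunit : IsUnit A)
    (hA : Aᴴ * (Matrix.fromBlocks 0 1 (-1) 0 : Matrix (Fin m ⊕ Fin m) (Fin m ⊕ Fin m) ℂ) * A =
      Matrix.fromBlocks 0 1 (-1) 0)
    (X Y : Matrix (Fin m) (Fin m) ℂ)
    (hsym : Xᴴ * Y = Yᴴ * X)
    (hrank : (Matrix.fromRows X Y).rank = m)
    (W : Matrix (Fin m) (Fin m) ℂ)
    (hW : W = (X + Complex.I • Y) * (X - Complex.I • Y)⁻¹)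
    (C : Matrix (Fin m ⊕ Fin m) (Fin m ⊕ Fin m) ℂ)
    (hC : C = (1 + Complex.I)⁻¹ •
      Matrix.fromBlocks 1 (-(Complex.I • (1 : Matrix (Fin m) (Fin m) ℂ))) 1 (Complex.I • 1))
    (X₁ Y₁ : Matrix (Fin m) (Fin m) ℂ)
    (hX₁ : X₁ = (A * Matrix.fromRows X Y).toRows₁)
    (hY₁ : Y₁ = (A * Matrix.fromRows X Y).toRows₂)
    (A₁ A₂ A₃ A₄ : Matrix (Fin m) (Fin m) ℂ)
    (hA₁ : A₁ = (C * A * C⁻¹).toBlocks₁₁) (hA₂ : A₂ = (C * A * C⁻¹).toBlocks₁₂)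
    (hA₃ : A₃ = (C * A * C⁻¹).toBlocks₂₁) (hA₄ : A₄ = (C * A * C⁻¹).toBlocks₂₂) :
    X₁ᴴ * Y₁ = Y₁ᴴ * X₁ ∧
    (Matrix.fromRows X₁ Y₁).rank = m ∧
    IsUnit (A₁ + A₂ * W) ∧
    (X₁ + Complex.I • Y₁) * (X₁ - Complex.I • Y₁)⁻¹ =
      (A₃ + A₄ * W) * (A₁ + A₂ * W)⁻¹ := by
  have hF : A * fromRows X Y = fromRows X₁ Y₁ := by rw [hX₁, hY₁, fromRows_toRows]
  have hsym₁ : X₁ᴴ * Y₁ = Y₁ᴴ * X₁ := by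
    rw [← sub_eq_zero, ← conjTranspose_fromRows_mul_J_mul_fromRows, ← hF, conjTranspose_mul]
    rw [← sub_eq_zero, ← conjTranspose_fromRows_mul_J_mul_fromRows, ← hA] at hsym
    simpa only [Matrix.mul_assoc] using hsym
  have hrank₁ : (fromRows X₁ Y₁).rank = m := by
    rw [← hF, rank_mul_eq_right_of_isUnit_det _ _ (A.isUnit_iff_isUnit_det.mp hAunit), hrank]
  have hP : IsUnit (X - Complex.I • Y) :=
    isUnit_sub_I_smul_of_rank_fromRows hsym (by simpa using hrank)
  have hP₁ : IsUnit (X₁ - Complex.I • Y₁) :=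
    isUnit_sub_I_smul_of_rank_fromRows hsym₁ (by simpa using hrank₁)
  have hQ : X + Complex.I • Y = W * (X - Complex.I • Y) := by
    rw [hW, nonsing_inv_mul_cancel_right _ _ ((isUnit_iff_isUnit_det _).mp hP)]
  have hconj := cayley_conj_mul_fromRows hC A hF
  rw [← fromBlocks_toBlocks (C * A * C⁻¹), ← hA₁, ← hA₂, ← hA₃, ← hA₄,
    fromBlocks_mul_fromRows, fromRows_inj.eq_iff, hQ, ← Matrix.mul_assoc, ← Matrix.mul_assoc,
    ← add_mul, ← add_mul] at hconj
  obtain ⟨hden, hnum⟩ := hconj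
  refine ⟨hsym₁, hrank₁, ?_, ?_⟩
  · rw [← hden] at hP₁
    exact isUnit_of_mul_isUnit_left hP₁
  · rw [← hden, ← hnum, Matrix.mul_inv_rev, Matrix.mul_assoc,
      mul_nonsing_inv_cancel_left _ _ ((isUnit_iff_isUnit_det _).mp hP)]
end

section
/- Every A ∈ GL(2m,ℂ) with AᴴηA = η, where η = [[I_m, 0],[0, −I_m]], admits a decomposition A = [[U₁, 0],[0, U₂]] · [[cosh Γ, sinh Γ],[sinh Γ, cosh Γ]] · [[V₁, 0],[0, V₂]], where U₁, U₂, V₁, V₂ are m×m unitary matrices and Γ is an m×m real diagonal matrix with nonnegative diagonal entries (cosh and sinh applied entrywise on the diagonal). -/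
open Matrix

/-- A square matrix whose columns are pairwise orthogonal with norms `σ i` is a unitary matrix
times `diagonal σ`. -/
theorem Matrix.exists_unitary_mul_diagonal {𝕜 n : Type*} [RCLike 𝕜] [Fintype n] [DecidableEq n]
    (M : Matrix n n 𝕜) (σ : n → ℝ)
    (hM : Mᴴ * M = Matrix.diagonal fun i => ((σ i ^ 2 : ℝ) : 𝕜)) :
    ∃ U : Matrix n n 𝕜, Uᴴ * U = 1 ∧ M = U * Matrix.diagonal fun i => (σ i : 𝕜) := by
  have hcol : ∀ i j, ∑ k, star (M k i) * M k j = if i = j then ((σ i ^ 2 : ℝ) : 𝕜) else 0 := by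
    intro i j
    have h := congrFun (congrFun hM i) j
    simpa [Matrix.mul_apply, Matrix.diagonal_apply] using h
  let v : n → EuclideanSpace 𝕜 n := fun i => WithLp.toLp 2 fun k => ((σ i)⁻¹ : 𝕜) * M k i
  have hv : Orthonormal 𝕜 (({i | σ i ≠ 0} : Set n).domRestrict v) := by
    rw [orthonormal_iff_ite]
    rintro ⟨i, hi⟩ ⟨j, hj⟩
    have hi' : (σ i : 𝕜) ≠ 0 := by exact_mod_cast hi
    have h : inner 𝕜 (v i) (v j) =
        (σ i : 𝕜)⁻¹ * (σ j : 𝕜)⁻¹ * ∑ k, star (M k i) * M k j := by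
      simp only [v, PiLp.inner_apply, RCLike.inner_apply, Finset.mul_sum, map_mul, map_inv₀,
        RCLike.conj_ofReal, RCLike.star_def]
      exact Finset.sum_congr rfl fun k _ => by ring
    change inner 𝕜 (v i) (v j) = _
    simp only [h, hcol, Subtype.mk.injEq]
    split_ifs with hij
    · subst hij
      push_cast
      field_simp
    · simp
  obtain ⟨b, hb⟩ := hv.exists_orthonormalBasis_extension_of_card_eq (by simp)
  refine ⟨Matrix.of fun k i => b i k, ?_, ?_⟩
  · ext i j
    have h := orthonormal_iff_ite.mp b.orthonormal i j
    simpa [Matrix.mul_apply, Matrix.one_apply, PiLp.inner_apply, mul_comm] using h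
  · ext k i
    rw [Matrix.mul_diagonal, Matrix.of_apply]
    by_cases hi : σ i = 0
    · have h : ∑ k, ‖M k i‖ ^ 2 = 0 := by
        have h := hcol i i
        simp only [RCLike.star_def, RCLike.conj_mul, if_pos, hi] at h
        have h' : ((∑ k, ‖M k i‖ ^ 2 : ℝ) : 𝕜) = ((0 : ℝ) : 𝕜) := by
          push_cast
          simpa using h
        exact_mod_cast h'
      have hk := (Finset.sum_eq_zero_iff_of_nonneg fun k _ => sq_nonneg ‖M k i‖).mp h k
        (Finset.mem_univ k)
      simpa [hi] using hk
    · have hi' : (σ i : 𝕜) ≠ 0 := by exact_mod_cast hi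
      rw [hb i hi]
      simp only [v]
      field_simp

open scoped ComplexOrder in
/-- Singular value decomposition of a square matrix. -/
theorem Matrix.exists_svd {𝕜 n : Type*} [RCLike 𝕜] [Fintype n] [DecidableEq n]
    (M : Matrix n n 𝕜) :
    ∃ (U V : Matrix n n 𝕜) (σ : n → ℝ), Uᴴ * U = 1 ∧ Vᴴ * V = 1 ∧ (∀ i, 0 ≤ σ i) ∧
      M = U * Matrix.diagonal (fun i => (σ i : 𝕜)) * V := by
  have hpos := Matrix.posSemidef_conjTranspose_mul_self M
  have hH := hpos.isHermitian
  let W : Matrix n n 𝕜 := hH.eigenvectorUnitary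
  have hW₁ : Wᴴ * W = 1 := Unitary.coe_star_mul_self hH.eigenvectorUnitary
  have hW₂ : W * Wᴴ = 1 := Unitary.coe_mul_star_self hH.eigenvectorUnitary
  have hspec : Mᴴ * M = W * Matrix.diagonal (fun i => (hH.eigenvalues i : 𝕜)) * Wᴴ :=
    hH.spectral_theorem
  obtain ⟨U, hU, hMU⟩ := Matrix.exists_unitary_mul_diagonal (M * W)
    (fun i => √(hH.eigenvalues i)) (by
      simp only [Real.sq_sqrt (hpos.eigenvalues_nonneg _)]
      calc (M * W)ᴴ * (M * W) = Wᴴ * (Mᴴ * M) * W := by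
            simp only [Matrix.conjTranspose_mul, Matrix.mul_assoc]
        _ = (Wᴴ * W) * Matrix.diagonal (fun i => (hH.eigenvalues i : 𝕜)) * (Wᴴ * W) := by
            conv_lhs => rw [hspec]
            simp only [Matrix.mul_assoc]
        _ = _ := by rw [hW₁, Matrix.one_mul, Matrix.mul_one])
  refine ⟨U, Wᴴ, fun i => √(hH.eigenvalues i), hU, by simpa using hW₂,
    fun i => Real.sqrt_nonneg _, ?_⟩
  rw [← hMU, Matrix.mul_assoc, hW₂, Matrix.mul_one]

/-- If `MᴴM = Vᴴ D² V` with `V` unitary and `D` invertible with Hermitian inverse `E`, then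
`M = U D V` with `U` unitary. -/
theorem Matrix.exists_unitary_mul_mul {𝕜 n : Type*} [RCLike 𝕜] [Fintype n] [DecidableEq n]
    {M V D E : Matrix n n 𝕜} (hV : Vᴴ * V = 1) (hE : Eᴴ = E) (hED : E * D = 1)
    (hM : Mᴴ * M = Vᴴ * (D * D) * V) :
    ∃ U : Matrix n n 𝕜, Uᴴ * U = 1 ∧ M = U * D * V := by
  have hV' : V * Vᴴ = 1 := mul_eq_one_comm.mp hV
  have hDE : D * E = 1 := mul_eq_one_comm.mp hED
  refine ⟨M * Vᴴ * E, ?_, ?_⟩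
  · calc (M * Vᴴ * E)ᴴ * (M * Vᴴ * E) = E * V * (Mᴴ * M) * Vᴴ * E := by
          simp only [Matrix.conjTranspose_mul, Matrix.conjTranspose_conjTranspose, hE,
            Matrix.mul_assoc]
      _ = E * (V * Vᴴ) * (D * D) * (V * Vᴴ) * E := by rw [hM]; simp only [Matrix.mul_assoc]
      _ = (E * D) * (D * E) := by
          rw [hV', Matrix.mul_one, Matrix.mul_one]; simp only [Matrix.mul_assoc]
      _ = 1 := by rw [hED, hDE, Matrix.mul_one]
  · rw [Matrix.mul_assoc (M * Vᴴ), hED, Matrix.mul_one, Matrix.mul_assoc, hV, Matrix.mul_one]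

/-- (Singular value decomposition in `U(m,m)`.) Every `A ∈ GL(2m, ℂ)` with
`Aᴴ η A = η`, `η = [[I, 0],[0, -I]]`, can be written as
`[[U₁, 0],[0, U₂]] · [[cosh Γ, sinh Γ],[sinh Γ, cosh Γ]] · [[V₁, 0],[0, V₂]]`
with `U₁, U₂, V₁, V₂` unitary and `Γ` real diagonal with nonnegative entries. -/
theorem pseudo_unitary_svd (m : ℕ)
    (A : Matrix (Fin m ⊕ Fin m) (Fin m ⊕ Fin m) ℂ)
    (hAunit : IsUnit A)
    (hA : Aᴴ * (Matrix.fromBlocks 1 0 0 (-1) : Matrix (Fin m ⊕ Fin m) (Fin m ⊕ Fin m) ℂ) * A =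
      Matrix.fromBlocks 1 0 0 (-1)) :
    ∃ (U₁ U₂ V₁ V₂ : Matrix (Fin m) (Fin m) ℂ) (Γ : Fin m → ℝ),
      U₁ᴴ * U₁ = 1 ∧ U₂ᴴ * U₂ = 1 ∧ V₁ᴴ * V₁ = 1 ∧ V₂ᴴ * V₂ = 1 ∧
      (∀ i, 0 ≤ Γ i) ∧
      A = Matrix.fromBlocks U₁ 0 0 U₂ *
          Matrix.fromBlocks
            (Matrix.diagonal fun i => (Real.cosh (Γ i) : ℂ))
            (Matrix.diagonal fun i => (Real.sinh (Γ i) : ℂ))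
            (Matrix.diagonal fun i => (Real.sinh (Γ i) : ℂ))
            (Matrix.diagonal fun i => (Real.cosh (Γ i) : ℂ)) *
          Matrix.fromBlocks V₁ 0 0 V₂ := by
  obtain ⟨a, b, c, d, rfl⟩ : ∃ a b c d, A = Matrix.fromBlocks a b c d :=
    ⟨_, _, _, _, (Matrix.fromBlocks_toBlocks A).symm⟩
  have hA' : Matrix.fromBlocks a b c d * Matrix.fromBlocks 1 0 0 (-1) *
      (Matrix.fromBlocks a b c d)ᴴ = Matrix.fromBlocks 1 0 0 (-1) := by
    set η : Matrix (Fin m ⊕ Fin m) (Fin m ⊕ Fin m) ℂ := Matrix.fromBlocks 1 0 0 (-1)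
    have hη : η * η = 1 := by simp [η, Matrix.fromBlocks_multiply]
    set A := Matrix.fromBlocks a b c d
    have h : (A * η * Aᴴ) * η = 1 := by
      have h₁ : (η * Aᴴ * η) * A = 1 := by
        rw [← hη, Matrix.mul_assoc η, Matrix.mul_assoc η, hA]
      rw [← mul_eq_one_comm.mp h₁]
      simp only [Matrix.mul_assoc]
    calc A * η * Aᴴ = (A * η * Aᴴ) * η * η := by rw [Matrix.mul_assoc _ η η, hη, Matrix.mul_one]
      _ = η := by rw [h, Matrix.one_mul]
  simp only [Matrix.fromBlocks_conjTranspose, Matrix.fromBlocks_multiply, Matrix.mul_one,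
    Matrix.mul_zero, Matrix.mul_neg, Matrix.neg_mul, add_zero, zero_add,
    Matrix.fromBlocks_inj] at hA hA'
  obtain ⟨haa, hab, -, -⟩ := hA
  obtain ⟨-, -, -, hdd⟩ := hA'
  obtain ⟨U₂, V₁, σ, hU₂, hV₁, hσ, hc⟩ := Matrix.exists_svd c
  have hU₂' : U₂ * U₂ᴴ = 1 := mul_eq_one_comm.mp hU₂
  have hV₁' : V₁ * V₁ᴴ = 1 := mul_eq_one_comm.mp hV₁
  let Γ : Fin m → ℝ := fun i => Real.arsinh (σ i)
  let S : Matrix (Fin m) (Fin m) ℂ := Matrix.diagonal fun i => (Real.sinh (Γ i) : ℂ)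
  let C : Matrix (Fin m) (Fin m) ℂ := Matrix.diagonal fun i => (Real.cosh (Γ i) : ℂ)
  let E : Matrix (Fin m) (Fin m) ℂ := Matrix.diagonal fun i => (((Real.cosh (Γ i))⁻¹ : ℝ) : ℂ)
  have hcS : c = U₂ * S * V₁ := by
    simp only [S, Γ, Real.sinh_arsinh]
    exact hc
  have hSH : Sᴴ = S := by
    simp only [S, Matrix.diagonal_conjTranspose]
    congr 1; ext i; exact Complex.conj_ofReal _
  have hCH : Cᴴ = C := by
    simp only [C, Matrix.diagonal_conjTranspose]
    congr 1; ext i; exact Complex.conj_ofReal _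
  have hEH : Eᴴ = E := by
    simp only [E, Matrix.diagonal_conjTranspose]
    congr 1; ext i; exact Complex.conj_ofReal _
  have hEC : E * C = 1 := by
    simp only [E, C, Matrix.diagonal_mul_diagonal, ← Matrix.diagonal_one]
    congr 1; ext i
    exact_mod_cast inv_mul_cancel₀ (Real.cosh_pos (Γ i)).ne'
  have hSC : S * C = C * S := by
    simp only [S, C, Matrix.diagonal_mul_diagonal, mul_comm]
  have hCS : C * C = 1 + S * S := by
    simp only [S, C, Matrix.diagonal_mul_diagonal, ← Matrix.diagonal_one, Matrix.diagonal_add]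
    congr 1; ext i
    have h := Real.cosh_sq (Γ i)
    have h' : Real.cosh (Γ i) * Real.cosh (Γ i) = 1 + Real.sinh (Γ i) * Real.sinh (Γ i) := by
      linarith
    exact_mod_cast h'
  obtain ⟨U₁, hU₁, ha⟩ := Matrix.exists_unitary_mul_mul (M := a) hV₁ hEH hEC (by
    have hcc : cᴴ * c = V₁ᴴ * (S * S) * V₁ := by
      calc cᴴ * c = V₁ᴴ * S * (U₂ᴴ * U₂) * S * V₁ := by
            rw [hcS]; simp only [Matrix.conjTranspose_mul, hSH, Matrix.mul_assoc]
        _ = _ := by rw [hU₂, Matrix.mul_one]; simp only [Matrix.mul_assoc]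
    rw [hCS, Matrix.mul_add, Matrix.add_mul, ← hcc, Matrix.mul_one, hV₁, ← haa]
    abel)
  obtain ⟨X, hX, hd⟩ := Matrix.exists_unitary_mul_mul (M := dᴴ) (V := U₂ᴴ)
    (by simpa using hU₂') hEH hEC (by
      have hcc : c * cᴴ = U₂ * (S * S) * U₂ᴴ := by
        calc c * cᴴ = U₂ * S * (V₁ * V₁ᴴ) * S * U₂ᴴ := by
              rw [hcS]; simp only [Matrix.conjTranspose_mul, hSH, Matrix.mul_assoc]
          _ = _ := by rw [hV₁', Matrix.mul_one]; simp only [Matrix.mul_assoc]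
      rw [Matrix.conjTranspose_conjTranspose, Matrix.conjTranspose_conjTranspose, hCS,
        Matrix.mul_add, Matrix.add_mul, ← hcc, Matrix.mul_one, hU₂', ← sub_eq_zero]
      rw [← sub_eq_zero] at hdd
      rw [← neg_eq_zero, ← hdd]
      abel)
  have hdC : d = U₂ * C * Xᴴ := by
    rw [← Matrix.conjTranspose_conjTranspose d, hd]
    simp only [Matrix.conjTranspose_mul, Matrix.conjTranspose_conjTranspose, hCH,
      Matrix.mul_assoc]
  have hbS : b = U₁ * S * Xᴴ := by
    have hU₁' : U₁ * U₁ᴴ = 1 := mul_eq_one_comm.mp hU₁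
    have h : aᴴ * b = cᴴ * d := by
      rw [← sub_eq_zero, ← hab]; abel
    have h₁ : aᴴ * b = V₁ᴴ * (C * (U₁ᴴ * b)) := by
      rw [ha]; simp only [Matrix.conjTranspose_mul, hCH, Matrix.mul_assoc]
    have h₂ : cᴴ * d = V₁ᴴ * (C * (S * Xᴴ)) := by
      calc cᴴ * d = V₁ᴴ * S * (U₂ᴴ * U₂) * C * Xᴴ := by
            rw [hcS, hdC]; simp only [Matrix.conjTranspose_mul, hSH, Matrix.mul_assoc]
        _ = V₁ᴴ * (S * C) * Xᴴ := by rw [hU₂, Matrix.mul_one]; simp only [Matrix.mul_assoc]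
        _ = _ := by rw [hSC]; simp only [Matrix.mul_assoc]
    have cancel : ∀ Y : Matrix (Fin m) (Fin m) ℂ, U₁ * (E * (V₁ * (V₁ᴴ * (C * Y)))) = U₁ * Y := by
      intro Y
      rw [← Matrix.mul_assoc V₁, hV₁', Matrix.one_mul, ← Matrix.mul_assoc E, hEC, Matrix.one_mul]
    rw [Matrix.mul_assoc U₁, ← cancel, ← h₂, ← h, h₁, cancel, ← Matrix.mul_assoc, hU₁',
      Matrix.one_mul]
  refine ⟨U₁, U₂, V₁, Xᴴ, Γ, hU₁, hU₂, hV₁, ?_, fun i => Real.arsinh_nonneg_iff.mpr (hσ i), ?_⟩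
  · simpa using mul_eq_one_comm.mp hX
  · change _ = _ * Matrix.fromBlocks C S S C * _
    simp only [Matrix.fromBlocks_multiply, Matrix.mul_zero, Matrix.zero_mul, add_zero, zero_add]
    rw [← ha, ← hbS, ← hcS, ← hdC]
end

section
/- Let E ∈ ℝ, let f be an m×m Hermitian complex matrix (fᴴ = f), and let C be an invertible m×m complex matrix. Then the 2m×2m block matrix A_E = [[(E·I_m − f)·C⁻¹, −Cᴴ],[C⁻¹, 0]] is Hermitian symplectic: it is invertible and satisfies A_EᴴJA_E = J, where J = [[0, I_m],[−I_m, 0]]. -/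
open Matrix

/-- For `E ∈ ℝ`, `f` Hermitian and `C` invertible, the Schrödinger
transfer matrix `A_E = [[(E·I − f)·C⁻¹, −Cᴴ],[C⁻¹, 0]]` is Hermitian symplectic:
it is invertible and `A_Eᴴ J A_E = J` with `J = [[0, I],[−I, 0]]`. -/
theorem schrodinger_cocycle_hermitian_symplectic (m : ℕ) (E : ℝ)
    (f C : Matrix (Fin m) (Fin m) ℂ)
    (hf : fᴴ = f) (hC : IsUnit C)
    (A : Matrix (Fin m ⊕ Fin m) (Fin m ⊕ Fin m) ℂ)
    (hA : A = Matrix.fromBlocks (((E : ℂ) • 1 - f) * C⁻¹) (-Cᴴ) C⁻¹ 0) :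
    IsUnit A ∧
    Aᴴ * (Matrix.fromBlocks 0 1 (-1) 0 : Matrix (Fin m ⊕ Fin m) (Fin m ⊕ Fin m) ℂ) * A =
      Matrix.fromBlocks 0 1 (-1) 0 := by
  have hdet : IsUnit C.det := (isUnit_iff_isUnit_det C).mp hC
  have hCC : C * C⁻¹ = 1 := mul_nonsing_inv C hdet
  have hCC' : (C⁻¹)ᴴ * Cᴴ = 1 := by
    rw [← conjTranspose_mul, hCC, conjTranspose_one]
  have hsymp : Aᴴ * (fromBlocks 0 1 (-1) 0 : Matrix (Fin m ⊕ Fin m) (Fin m ⊕ Fin m) ℂ) * A =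
      fromBlocks 0 1 (-1) 0 := by
    have hEf : ((E : ℂ) • (1 : Matrix (Fin m) (Fin m) ℂ) - f)ᴴ = (E : ℂ) • 1 - f := by
      simp [conjTranspose_sub, conjTranspose_smul, hf]
    rw [hA, fromBlocks_conjTranspose, fromBlocks_multiply, fromBlocks_multiply,
      conjTranspose_mul, hEf]
    congr 1
    · simp [Matrix.mul_assoc]
    · simp [hCC']
    · simp [hCC]
    · simp
  refine ⟨?_, hsymp⟩
  have hJ : (fromBlocks 0 1 (-1) 0 : Matrix (Fin m ⊕ Fin m) (Fin m ⊕ Fin m) ℂ) *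
      fromBlocks 0 (-1) 1 0 = 1 := by
    simp [fromBlocks_multiply]
  have hJ' := mul_eq_one_comm.mp hJ
  refine IsUnit.of_mul_eq_one_right (fromBlocks 0 (-1) 1 0 * (Aᴴ * fromBlocks 0 1 (-1) 0)) ?_
  rw [Matrix.mul_assoc, hsymp, hJ']
end

section
/- Let m, N ≥ 1, let B(1), …, B(N) be m×m Hermitian complex matrices, and let C be an invertible m×m complex matrix. Let H^N be the mN×mN block tridiagonal matrix whose (n,n) block is B(n), whose (n, n−1) block is Cᴴ, whose (n, n+1) block is C, and whose other blocks are 0. For z ∈ ℂ, define m×m matrices U_z(0) = 0, U_z(1) = I_m, and U_z(n+1) = C⁻¹·((z·I_m − B(n))·U_z(n) − Cᴴ·U_z(n−1)) for 1 ≤ n ≤ N. Then for every z ∈ ℂ, the dimension of the kernel of z·I_{mN} − H^N equals the dimension of the kernel of the m×m matrix U_z(N+1); in particular every eigenvalue of H^N has geometric (equivalently, since H^N is Hermitian, algebraic) multiplicity at most m. -/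
open Matrix

theorem Fin.sum_ite_val_add_one_eq {R : Type*} [AddCommMonoid R] (N : ℕ) (g : ℕ → R)
    (h0 : g 0 = 0) (hN : g (N + 1) = 0) (k : ℕ) (hk : k ≤ N + 1) :
    ∑ b : Fin N, (if (b : ℕ) + 1 = k then g (b + 1) else 0) = g k := by
  rw [Fin.sum_univ_eq_sum_range (fun b => if b + 1 = k then g (b + 1) else 0) N]
  rcases k with _ | k
  · simp [h0]
  · simp only [add_left_inj, Finset.sum_ite_eq', Finset.mem_range]
    split_ifs with h
    · rfl
    · rw [show k = N by omega, hN]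

section BlockTridiagonal

variable {N : ℕ} {ι K : Type*} [Fintype ι] [Field K]
  {B : ℕ → Matrix ι ι K} {C D : Matrix ι ι K} {H : Matrix (Fin N × ι) (Fin N × ι) K}

/-- The action of a block tridiagonal matrix on a block vector that is extended by zero at the
two boundary sites. -/
theorem block_tridiagonal_mulVec_apply
    (hH : ∀ (a b : Fin N) (i j : ι), H (a, i) (b, j) =
      if (a : ℕ) = (b : ℕ) then B ((a : ℕ) + 1) i j
      else if (b : ℕ) + 1 = (a : ℕ) then D i j
      else if (a : ℕ) + 1 = (b : ℕ) then C i j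
      else 0)
    (V : ℕ → ι → K) (h0 : V 0 = 0) (hN : V (N + 1) = 0) (a : Fin N) (i : ι) :
    (H *ᵥ fun p => V (p.1 + 1) p.2) (a, i) =
      (B (a + 1) *ᵥ V (a + 1) + D *ᵥ V a + C *ᵥ V (a + 2)) i := by
  have key : ∀ (M : Matrix ι ι K) (k : ℕ), k ≤ N + 1 →
      ∑ b : Fin N, (if (b : ℕ) + 1 = k then (M *ᵥ V (b + 1)) i else 0) = (M *ᵥ V k) i :=
    fun M k hk => Fin.sum_ite_val_add_one_eq N (fun n => (M *ᵥ V n) i)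
      (by simp [h0]) (by simp [hN]) k hk
  have ha := a.isLt
  simp only [Pi.add_apply]
  rw [← key (B (a + 1)) (a + 1) (by omega), ← key D a (by omega), ← key C (a + 2) (by omega),
    ← Finset.sum_add_distrib, ← Finset.sum_add_distrib, mulVec, dotProduct,
    Fintype.sum_prod_type]
  refine Finset.sum_congr rfl fun b _ => ?_
  simp only [hH]
  by_cases h1 : (a : ℕ) = b
  · simp [h1, mulVec, dotProduct]
  by_cases h2 : (b : ℕ) + 1 = a
  · have h3 : ¬ (b : ℕ) + 1 = a + 1 := by omega
    have h4 : ¬ (b : ℕ) + 1 = a + 2 := by omega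
    simp only [if_neg h1, if_pos h2, if_neg h3, if_neg h4, zero_add, add_zero, mulVec, dotProduct]
  by_cases h3 : (a : ℕ) + 1 = b
  · have h4 : (b : ℕ) + 1 = a + 2 := by omega
    have h5 : ¬ (b : ℕ) + 1 = a + 1 := by omega
    simp only [if_neg h1, if_neg h2, if_pos h3, if_pos h4, if_neg h5, zero_add, mulVec, dotProduct]
  · have h4 : ¬ (b : ℕ) + 1 = a + 2 := by omega
    have h5 : ¬ (b : ℕ) + 1 = a + 1 := by omega
    simp only [if_neg h1, if_neg h2, if_neg h3, if_neg h4, if_neg h5, zero_mul, add_zero,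
      Finset.sum_const_zero]

variable [DecidableEq ι]

/-- The eigenvalue equation of a block tridiagonal matrix is a three-term recursion with
Dirichlet boundary conditions. -/
theorem block_tridiagonal_mem_ker_iff
    (hH : ∀ (a b : Fin N) (i j : ι), H (a, i) (b, j) =
      if (a : ℕ) = (b : ℕ) then B ((a : ℕ) + 1) i j
      else if (b : ℕ) + 1 = (a : ℕ) then D i j
      else if (a : ℕ) + 1 = (b : ℕ) then C i j
      else 0)
    (z : K) (V : ℕ → ι → K) (h0 : V 0 = 0) (hN : V (N + 1) = 0) :
    (fun p : Fin N × ι => V (p.1 + 1) p.2) ∈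
        LinearMap.ker (z • (1 : Matrix (Fin N × ι) (Fin N × ι) K) - H).mulVecLin ↔
      ∀ n < N, C *ᵥ V (n + 2) = (z • 1 - B (n + 1)) *ᵥ V (n + 1) - D *ᵥ V n := by
  have hrow : ∀ (a : Fin N) (i : ι),
      ((z • (1 : Matrix (Fin N × ι) (Fin N × ι) K) - H) *ᵥ fun p => V (p.1 + 1) p.2) (a, i) =
        (((z • 1 - B (a + 1)) *ᵥ V (a + 1) - D *ᵥ V a - C *ᵥ V (a + 2) : ι → K) i) := fun a i => by
    rw [sub_mulVec, Pi.sub_apply, block_tridiagonal_mulVec_apply hH V h0 hN]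
    simp only [sub_mulVec, smul_mulVec, one_mulVec, Pi.sub_apply, Pi.add_apply, Pi.smul_apply]
    ring
  rw [LinearMap.mem_ker, mulVecLin_apply]
  constructor
  · intro h n hn
    refine (sub_eq_zero.mp (funext fun i => ?_)).symm
    rw [← hrow ⟨n, hn⟩ i, h]
    rfl
  · intro h
    funext ⟨a, i⟩
    rw [hrow, h a a.isLt, sub_self]
    rfl

/-- The kernel of `z - H` is parametrized by the kernel of the last transfer matrix. -/
theorem block_tridiagonal_finrank_ker_eq (hN : 1 ≤ N) (hC : IsUnit C)
    (hH : ∀ (a b : Fin N) (i j : ι), H (a, i) (b, j) =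
      if (a : ℕ) = (b : ℕ) then B ((a : ℕ) + 1) i j
      else if (b : ℕ) + 1 = (a : ℕ) then D i j
      else if (a : ℕ) + 1 = (b : ℕ) then C i j
      else 0)
    (z : K) (U : ℕ → Matrix ι ι K) (hU0 : U 0 = 0) (hU1 : U 1 = 1)
    (hU : ∀ n < N, C * U (n + 2) = (z • 1 - B (n + 1)) * U (n + 1) - D * U n) :
    Module.finrank K
        (LinearMap.ker (z • (1 : Matrix (Fin N × ι) (Fin N × ι) K) - H).mulVecLin) =
      Module.finrank K (LinearMap.ker (U (N + 1)).mulVecLin) := by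
  let Φ : (ι → K) →ₗ[K] (Fin N × ι → K) :=
    LinearMap.pi fun p => LinearMap.proj p.2 ∘ₗ (U (p.1 + 1)).mulVecLin
  have hΦ : ∀ v, Φ v = fun p : Fin N × ι => (U (p.1 + 1) *ᵥ v) p.2 := fun v => rfl
  have hinj : Function.Injective Φ := fun v w h => funext fun i => by
    simpa [hΦ, hU1] using congrFun h (⟨0, hN⟩, i)
  have hmap : (LinearMap.ker (U (N + 1)).mulVecLin).map Φ =
      LinearMap.ker (z • (1 : Matrix (Fin N × ι) (Fin N × ι) K) - H).mulVecLin := by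
    ext u
    constructor
    · rintro ⟨v, hv, rfl⟩
      rw [hΦ]
      refine (block_tridiagonal_mem_ker_iff hH z (fun n => U n *ᵥ v) (by simp [hU0]) hv).mpr ?_
      intro n hn
      simp only [mulVec_mulVec, hU n hn, sub_mulVec]
    · intro hu
      let V : ℕ → ι → K := fun n i =>
        if h : 1 ≤ n ∧ n ≤ N then u (⟨n - 1, by omega⟩, i) else 0
      have hV0 : V 0 = 0 := by funext i; simp [V]
      have hVN : V (N + 1) = 0 := by funext i; simp [V]
      have huV : u = fun p : Fin N × ι => V (p.1 + 1) p.2 := by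
        funext ⟨a, i⟩
        have ha : (a : ℕ) + 1 ≤ N := a.isLt
        simp [V, ha]
      have hrec := (block_tridiagonal_mem_ker_iff hH z V hV0 hVN).mp (huV ▸ hu)
      have hVU : ∀ n ≤ N, V n = U n *ᵥ V 1 ∧ V (n + 1) = U (n + 1) *ᵥ V 1 := by
        intro n
        induction n with
        | zero => simp [hU0, hU1, hV0]
        | succ n ih =>
          intro hn
          obtain ⟨hn0, hn1⟩ := ih (by omega)
          refine ⟨hn1, mulVec_injective_iff_isUnit.mpr hC ?_⟩
          rw [hrec n hn, mulVec_mulVec, hU n hn, sub_mulVec (_ * _), ← mulVec_mulVec,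
            ← mulVec_mulVec, ← hn0, ← hn1]
      refine ⟨V 1, ?_, ?_⟩
      · exact (hVU N le_rfl).2.symm.trans hVN
      · rw [hΦ, huV]
        funext p
        rw [(hVU p.1 p.1.isLt.le).2]
  rw [← hmap]
  exact (Submodule.equivMapOfInjective Φ hinj _).finrank_eq.symm

end BlockTridiagonal

/-- With `H^N` the block tridiagonal matrix with Hermitian diagonal blocks
`B(1), …, B(N)`, subdiagonal blocks `Cᴴ`, superdiagonal blocks `C` (`C` invertible), and
`U_z` the transfer-matrix solution (`U_z(0) = 0`, `U_z(1) = I`,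
`U_z(n+1) = C⁻¹((z·I − B(n))U_z(n) − Cᴴ U_z(n−1))`), for every `z ∈ ℂ` the dimension of
`ker (z·I − H^N)` equals the dimension of `ker U_z(N+1)`; in particular every eigenvalue of
`H^N` has geometric multiplicity at most `m`. -/
theorem block_tridiagonal_eigenvalue_multiplicity (m N : ℕ) (hm : 1 ≤ m) (hN : 1 ≤ N)
    (B : ℕ → Matrix (Fin m) (Fin m) ℂ)
    (hB : ∀ n, 1 ≤ n → n ≤ N → (B n)ᴴ = B n)
    (C : Matrix (Fin m) (Fin m) ℂ) (hC : IsUnit C)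
    (H : Matrix (Fin N × Fin m) (Fin N × Fin m) ℂ)
    (hH : ∀ (a b : Fin N) (i j : Fin m), H (a, i) (b, j) =
      if (a : ℕ) = (b : ℕ) then B ((a : ℕ) + 1) i j
      else if (b : ℕ) + 1 = (a : ℕ) then Cᴴ i j
      else if (a : ℕ) + 1 = (b : ℕ) then C i j
      else 0)
    (z : ℂ)
    (U : ℕ → Matrix (Fin m) (Fin m) ℂ)
    (hU0 : U 0 = 0) (hU1 : U 1 = 1)
    (hUrec : ∀ n, 1 ≤ n → n ≤ N →
      U (n + 1) = C⁻¹ * ((z • 1 - B n) * U n - Cᴴ * U (n - 1))) :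
    Module.finrank ℂ
        (LinearMap.ker (z • (1 : Matrix (Fin N × Fin m) (Fin N × Fin m) ℂ) - H).mulVecLin) =
      Module.finrank ℂ (LinearMap.ker (U (N + 1)).mulVecLin) ∧
    Module.finrank ℂ
        (LinearMap.ker (z • (1 : Matrix (Fin N × Fin m) (Fin N × Fin m) ℂ) - H).mulVecLin) ≤ m :=
  by
  have hdet : IsUnit C.det := (isUnit_iff_isUnit_det C).mp hC
  have heq := block_tridiagonal_finrank_ker_eq hN hC hH z U hU0 hU1 fun n hn => by
    rw [hUrec (n + 1) (by omega) hn, mul_nonsing_inv_cancel_left _ _ hdet, Nat.add_sub_cancel]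
  refine ⟨heq, heq.trans_le ?_⟩
  simpa using Submodule.finrank_le (LinearMap.ker (U (N + 1)).mulVecLin)
end

section
/- Let m, n ≥ 1, let f_0, …, f_{n−1} be m×m Hermitian complex matrices, and let C be an invertible m×m complex matrix. For E ∈ ℝ define A_E(k) = [[(E·I_m − f_k)·C⁻¹, −Cᴴ],[C⁻¹, 0]] and the transfer matrices A_{E,0} = I_{2m}, A_{E,k} = A_E(k−1)·A_E(k−2)⋯A_E(0). Then the map E ↦ A_{E,n} is differentiable (its entries are polynomials in E) and satisfies the identity A_{E,n}ᴴ · J · (d/dE)A_{E,n} = − Σ_{k=0}^{n−1} A_{E,k}ᴴ · D · A_{E,k}, where J = [[0, I_m],[−I_m, 0]] and D = [[(C⁻¹)ᴴ·C⁻¹, 0],[0, 0]]. In particular, A_{E,n}ᴴ·J·(d/dE)A_{E,n} is a negative semidefinite Hermitian matrix. -/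
open Matrix
open scoped ComplexOrder

theorem Matrix.hasDerivAt_mul_apply {ι : Type*} [Fintype ι] {A B : ℝ → Matrix ι ι ℂ}
    {A' B' : Matrix ι ι ℂ} {x : ℝ}
    (hA : ∀ i j, HasDerivAt (fun t => A t i j) (A' i j) x)
    (hB : ∀ i j, HasDerivAt (fun t => B t i j) (B' i j) x) (i j : ι) :
    HasDerivAt (fun t => (A t * B t) i j) ((A' * B x + A x * B') i j) x := by
  simp only [Matrix.add_apply, Matrix.mul_apply, ← Finset.sum_add_distrib]
  exact HasDerivAt.fun_sum fun l _ => (hA i l).mul (hB l j)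

section TransferMatrix

variable {ι : Type*} [Fintype ι] [DecidableEq ι] (g C : Matrix ι ι ℂ)

/-- The one-step transfer matrix `[[(E·I − g)·C⁻¹, −Cᴴ],[C⁻¹, 0]]`. -/
noncomputable def transferStep (E : ℝ) : Matrix (ι ⊕ ι) (ι ⊕ ι) ℂ :=
  Matrix.fromBlocks (((E : ℂ) • 1 - g) * C⁻¹) (-Cᴴ) C⁻¹ 0

theorem hasDerivAt_transferStep_apply (E : ℝ) (p q : ι ⊕ ι) :
    HasDerivAt (fun t => transferStep g C t p q)
      ((Matrix.fromBlocks C⁻¹ 0 0 0 : Matrix (ι ⊕ ι) (ι ⊕ ι) ℂ) p q) E := by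
  rcases p with i | i <;> rcases q with j | j <;>
    simp only [transferStep, Matrix.fromBlocks_apply₁₁, Matrix.fromBlocks_apply₁₂,
      Matrix.fromBlocks_apply₂₁, Matrix.fromBlocks_apply₂₂, Matrix.zero_apply]
  · simp only [Matrix.sub_mul, Matrix.smul_mul, Matrix.one_mul, Matrix.sub_apply,
      Matrix.smul_apply, smul_eq_mul]
    simpa using (((hasDerivAt_id E).ofReal_comp).mul_const (C⁻¹ i j)).sub_const ((g * C⁻¹) i j)
  all_goals exact hasDerivAt_const _ _

variable {g C}

theorem conjTranspose_transferStep_mul_J_mul_self (hg : gᴴ = g) (hC : IsUnit C) (E : ℝ) :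
    (transferStep g C E)ᴴ * Matrix.fromBlocks 0 1 (-1) 0 * transferStep g C E =
      Matrix.fromBlocks 0 1 (-1) 0 := by
  have hdet : IsUnit C.det := (Matrix.isUnit_iff_isUnit_det C).mp hC
  have hCC : (C⁻¹)ᴴ * Cᴴ = 1 := by
    rw [← Matrix.conjTranspose_mul, Matrix.mul_nonsing_inv C hdet, Matrix.conjTranspose_one]
  simp [transferStep, Matrix.fromBlocks_conjTranspose, Matrix.fromBlocks_multiply, hg, hCC,
    Matrix.mul_nonsing_inv C hdet, Matrix.mul_assoc]

theorem conjTranspose_transferStep_mul_J_mul_deriv (E : ℝ) :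
    (transferStep g C E)ᴴ * Matrix.fromBlocks 0 1 (-1) 0 * Matrix.fromBlocks C⁻¹ 0 0 0 =
      -(Matrix.fromBlocks ((C⁻¹)ᴴ * C⁻¹) 0 0 0 : Matrix (ι ⊕ ι) (ι ⊕ ι) ℂ) := by
  simp [transferStep, Matrix.fromBlocks_conjTranspose, Matrix.fromBlocks_multiply,
    Matrix.fromBlocks_neg]

theorem posSemidef_fromBlocks_conjTranspose_mul_self (B : Matrix ι ι ℂ) :
    (Matrix.fromBlocks (Bᴴ * B) 0 0 0 : Matrix (ι ⊕ ι) (ι ⊕ ι) ℂ).PosSemidef := by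
  have h := Matrix.posSemidef_conjTranspose_mul_self
    (Matrix.fromBlocks B 0 0 0 : Matrix (ι ⊕ ι) (ι ⊕ ι) ℂ)
  simpa [Matrix.fromBlocks_conjTranspose, Matrix.fromBlocks_multiply] using h

theorem exists_hasDerivAt_transfer {n : ℕ} {f : ℕ → Matrix ι ι ℂ}
    (hf : ∀ k, k < n → (f k)ᴴ = f k) (hC : IsUnit C)
    {T : ℝ → ℕ → Matrix (ι ⊕ ι) (ι ⊕ ι) ℂ} (hT0 : ∀ E, T E 0 = 1)
    (hTsucc : ∀ E k, k < n → T E (k + 1) = transferStep (f k) C E * T E k)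
    (E : ℝ) (k : ℕ) (hk : k ≤ n) :
    ∃ A' : Matrix (ι ⊕ ι) (ι ⊕ ι) ℂ,
      (∀ p q, HasDerivAt (fun t => T t k p q) (A' p q) E) ∧
      (T E k)ᴴ * Matrix.fromBlocks 0 1 (-1) 0 * A' =
        -∑ l ∈ Finset.range k, (T E l)ᴴ * Matrix.fromBlocks ((C⁻¹)ᴴ * C⁻¹) 0 0 0 * T E l := by
  induction k with
  | zero => exact ⟨0, fun p q => by simpa [hT0] using hasDerivAt_const E _, by simp⟩
  | succ k ih =>
    obtain ⟨A', hA', hid⟩ := ih (by omega)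
    refine ⟨Matrix.fromBlocks C⁻¹ 0 0 0 * T E k + transferStep (f k) C E * A', fun p q => ?_, ?_⟩
    · simp only [hTsucc _ k hk]
      exact Matrix.hasDerivAt_mul_apply (hasDerivAt_transferStep_apply (f k) C E) hA' p q
    · rw [Finset.sum_range_succ, neg_add, ← hid, hTsucc E k hk, Matrix.conjTranspose_mul]
      have hJ := conjTranspose_transferStep_mul_J_mul_self (hf k hk) hC E
      have hD := conjTranspose_transferStep_mul_J_mul_deriv (g := f k) (C := C) E
      generalize transferStep (f k) C E = S at hJ hD ⊢
      rw [← neg_mul, ← mul_neg, ← hD]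
      nth_rewrite 2 [← hJ]
      noncomm_ring

end TransferMatrix

/-- Let `A_E(k) = [[(E·I − f_k)·C⁻¹, −Cᴴ],[C⁻¹, 0]]` be the one-step
Schrödinger transfer matrices (with `f_0, …, f_{n−1}` Hermitian and `C` invertible) and let
`T E k` denote the `k`-step transfer matrix `A_E(k−1)⋯A_E(0)`. Then `E ↦ T E n` is
differentiable and
`(T E n)ᴴ · J · (d/dE)(T E n) = − Σ_{k<n} (T E k)ᴴ · D · (T E k)` where
`J = [[0, I],[−I, 0]]` and `D = [[(C⁻¹)ᴴ C⁻¹, 0],[0, 0]]`; in particular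
`(T E n)ᴴ · J · (d/dE)(T E n)` is negative semidefinite Hermitian. -/
theorem transfer_matrix_derivative_identity (m n : ℕ) (hm : 1 ≤ m) (hn : 1 ≤ n)
    (f : ℕ → Matrix (Fin m) (Fin m) ℂ)
    (hf : ∀ k, k < n → (f k)ᴴ = f k)
    (C : Matrix (Fin m) (Fin m) ℂ) (hC : IsUnit C)
    (T : ℝ → ℕ → Matrix (Fin m ⊕ Fin m) (Fin m ⊕ Fin m) ℂ)
    (hT0 : ∀ E : ℝ, T E 0 = 1)
    (hTsucc : ∀ (E : ℝ) (k : ℕ), k < n →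
      T E (k + 1) =
        Matrix.fromBlocks (((E : ℂ) • 1 - f k) * C⁻¹) (-Cᴴ) C⁻¹ 0 * T E k) :
    ∀ E : ℝ, ∃ A' : Matrix (Fin m ⊕ Fin m) (Fin m ⊕ Fin m) ℂ,
      (∀ p q, HasDerivAt (fun E' : ℝ => T E' n p q) (A' p q) E) ∧
      (T E n)ᴴ *
          (Matrix.fromBlocks 0 1 (-1) 0 : Matrix (Fin m ⊕ Fin m) (Fin m ⊕ Fin m) ℂ) * A' =
        -∑ k ∈ Finset.range n,
          (T E k)ᴴ * Matrix.fromBlocks ((C⁻¹)ᴴ * C⁻¹) 0 0 0 * (T E k) ∧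
      (-((T E n)ᴴ *
          (Matrix.fromBlocks 0 1 (-1) 0 : Matrix (Fin m ⊕ Fin m) (Fin m ⊕ Fin m) ℂ) *
          A')).PosSemidef := by
  intro E
  obtain ⟨A', hA', hid⟩ := exists_hasDerivAt_transfer hf hC hT0 hTsucc E n le_rfl
  refine ⟨A', hA', hid, ?_⟩
  rw [hid, neg_neg]
  exact Matrix.posSemidef_sum _ fun k _ =>
    (posSemidef_fromBlocks_conjTranspose_mul_self C⁻¹).conjTranspose_mul_mul_same (T E k)
end

section
/- For m ≥ 1, the subset { U ∈ U(m) : U − I_m is invertible } of the unitary group (i.e., the set of unitary matrices not having 1 as an eigenvalue), equipped with the subspace topology, is a contractible topological space. -/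
open Matrix

section

variable {n : Type*} [DecidableEq n]

lemma convex_add_conjTranspose_eq_one :
    Convex ℝ {W : Matrix n n ℂ | W + Wᴴ = 1} := by
  intro A hA B hB a b _ _ hab
  simp only [Set.mem_ofPred_eq] at hA hB ⊢
  calc a • A + b • B + (a • A + b • B)ᴴ = a • (A + Aᴴ) + b • (B + Bᴴ) := by
        simp only [Matrix.conjTranspose_add, Matrix.conjTranspose_smul, star_trivial, smul_add]
        abel
    _ = 1 := by rw [hA, hB, ← add_smul, hab, one_smul]

lemma nonempty_add_conjTranspose_eq_one :
    {W : Matrix n n ℂ | W + Wᴴ = 1}.Nonempty := by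
  refine ⟨(2⁻¹ : ℝ) • 1, ?_⟩
  rw [Set.mem_ofPred_eq, Matrix.conjTranspose_smul, Matrix.conjTranspose_one, star_trivial,
    ← add_smul]
  norm_num

variable [Fintype n]

/-- Inversion is continuous on the set of invertible complex matrices. -/
lemma continuousOn_matrix_inv :
    ContinuousOn (fun A : Matrix n n ℂ => A⁻¹) {A | IsUnit A} := by
  intro A hA
  obtain ⟨u, hu⟩ := (Matrix.isUnit_iff_isUnit_det A).1 hA
  exact (continuousAt_matrix_inv A (hu ▸ NormedRing.inverse_continuousAt u)).continuousWithinAt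

/-- A complex matrix whose Hermitian part is `1 / 2` is invertible. -/
lemma isUnit_of_add_conjTranspose_eq_one {W : Matrix n n ℂ} (hW : W + Wᴴ = 1) : IsUnit W := by
  rw [← Matrix.mulVec_injective_iff_isUnit]
  refine (injective_iff_map_eq_zero (Matrix.mulVecLin W)).2 fun x hx => ?_
  rw [Matrix.mulVecLin_apply] at hx
  have h₁ : star x ⬝ᵥ (Wᴴ *ᵥ x) = 0 := by
    rw [Matrix.dotProduct_mulVec, ← Matrix.star_mulVec, hx, star_zero, zero_dotProduct]
  have h₂ : star x ⬝ᵥ ((W + Wᴴ) *ᵥ x) = 0 := by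
    rw [Matrix.add_mulVec, dotProduct_add, h₁, hx, dotProduct_zero, add_zero]
  rw [hW, Matrix.one_mulVec] at h₂
  open scoped ComplexOrder in exact dotProduct_star_self_eq_zero.1 h₂

/-- The resolvent at `1` of a unitary matrix has Hermitian part `1 / 2`. -/
lemma inv_one_sub_add_conjTranspose {U : Matrix n n ℂ} (hU : Uᴴ * U = 1)
    (h : IsUnit (1 - U)) : (1 - U)⁻¹ + ((1 - U)⁻¹)ᴴ = 1 := by
  have hd := (Matrix.isUnit_iff_isUnit_det _).1 h
  have hr : (1 - U) * (1 - U)⁻¹ = 1 := Matrix.mul_nonsing_inv _ hd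
  have hr' : ((1 - U)⁻¹)ᴴ * (1 - Uᴴ) = 1 := by
    simpa using congrArg conjTranspose hr
  set V := (1 - U)⁻¹
  have key : (1 - Uᴴ) + (1 - U) = (1 - Uᴴ) * (1 - U) := by
    rw [mul_sub, mul_one, sub_mul, one_mul, hU]
    abel
  calc V + Vᴴ = (Vᴴ * (1 - Uᴴ)) * V + Vᴴ * ((1 - U) * V) := by rw [hr, hr', one_mul, mul_one]
    _ = Vᴴ * ((1 - Uᴴ) + (1 - U)) * V := by noncomm_ring
    _ = (Vᴴ * (1 - Uᴴ)) * ((1 - U) * V) := by rw [key]; noncomm_ring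
    _ = 1 := by rw [hr, hr', one_mul]

/-- If `W` has Hermitian part `1 / 2`, then `1 - W⁻¹` is unitary. -/
lemma one_sub_inv_mem_unitaryGroup {W : Matrix n n ℂ} (hW : W + Wᴴ = 1) :
    1 - W⁻¹ ∈ Matrix.unitaryGroup n ℂ := by
  have hd := (Matrix.isUnit_iff_isUnit_det _).1 (isUnit_of_add_conjTranspose_eq_one hW)
  have hr : W * W⁻¹ = 1 := Matrix.mul_nonsing_inv _ hd
  have hr' : (W⁻¹)ᴴ * Wᴴ = 1 := by simpa using congrArg conjTranspose hr
  rw [Matrix.mem_unitaryGroup_iff', Matrix.star_eq_conjTranspose, Matrix.conjTranspose_sub,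
    Matrix.conjTranspose_one]
  set V := W⁻¹
  have key : V + Vᴴ = Vᴴ * V := by
    calc V + Vᴴ = (Vᴴ * Wᴴ) * V + Vᴴ * (W * V) := by rw [hr, hr', one_mul, mul_one]
      _ = Vᴴ * (W + Wᴴ) * V := by noncomm_ring
      _ = Vᴴ * V := by rw [hW, mul_one]
  calc (1 - Vᴴ) * (1 - V) = 1 - (V + Vᴴ) + Vᴴ * V := by noncomm_ring
    _ = 1 := by rw [key]; noncomm_ring

/-- The Cayley transform: `U ↦ (1 - U)⁻¹` identifies the unitary matrices without eigenvalue `1`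
with the matrices of Hermitian part `1 / 2`. -/
noncomputable def cayleyHomeomorph :
    ({U : Matrix n n ℂ | U ∈ Matrix.unitaryGroup n ℂ ∧ IsUnit (U - 1)} : Set (Matrix n n ℂ)) ≃ₜ
      ({W : Matrix n n ℂ | W + Wᴴ = 1} : Set (Matrix n n ℂ)) where
  toFun U := ⟨(1 - U.1)⁻¹, inv_one_sub_add_conjTranspose
    (Matrix.mem_unitaryGroup_iff'.1 U.2.1) (IsUnit.sub_iff.1 U.2.2)⟩
  invFun W := ⟨1 - W.1⁻¹, one_sub_inv_mem_unitaryGroup W.2, by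
    rw [sub_sub_cancel_left]
    exact ((Matrix.isUnit_nonsing_inv_iff).2 (isUnit_of_add_conjTranspose_eq_one W.2)).neg⟩
  left_inv U := Subtype.ext <| by
    have h := (Matrix.isUnit_iff_isUnit_det _).1 (IsUnit.sub_iff.1 U.2.2)
    simp [Matrix.nonsing_inv_nonsing_inv _ h]
  right_inv W := Subtype.ext <| by
    have h := (Matrix.isUnit_iff_isUnit_det _).1 (isUnit_of_add_conjTranspose_eq_one W.2)
    simp [Matrix.nonsing_inv_nonsing_inv _ h]
  continuous_toFun := by
    refine Continuous.subtype_mk ?_ _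
    exact continuousOn_matrix_inv.comp_continuous (continuous_const.sub continuous_subtype_val)
      fun U => IsUnit.sub_iff.1 U.2.2
  continuous_invFun := by
    refine Continuous.subtype_mk ?_ _
    exact continuous_const.sub (continuousOn_matrix_inv.comp_continuous
      continuous_subtype_val fun W => isUnit_of_add_conjTranspose_eq_one W.2)

end

/-- The set of unitary `m × m` matrices `U` such that `U − I` is
invertible (i.e. `1` is not an eigenvalue of `U`), with the subspace topology, is
contractible. -/
theorem unitary_without_eigenvalue_one_contractible (m : ℕ) (hm : 1 ≤ m) :
    ContractibleSpace
      ({U : Matrix (Fin m) (Fin m) ℂ | U ∈ Matrix.unitaryGroup (Fin m) ℂ ∧ IsUnit (U - 1)} :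
        Set (Matrix (Fin m) (Fin m) ℂ)) := by
  have := convex_add_conjTranspose_eq_one.contractibleSpace
    (nonempty_add_conjTranspose_eq_one (n := Fin m))
  exact cayleyHomeomorph.contractibleSpace
end

section
/- Let X be a topological space, let m ≥ 1, and let f, g : X → U(m) be continuous maps into the unitary group such that for every x ∈ X the matrix g(x)⁻¹·f(x) − I_m is invertible (equivalently, 1 is not an eigenvalue of g(x)⁻¹·f(x)). Then f and g are homotopic as continuous maps from X to U(m). -/
open Matrix

open scoped unitInterval ComplexOrder

namespace Matrix

variable {n : Type*} [Fintype n] [DecidableEq n]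

/-- If `1` is not an eigenvalue of the unitary matrix `u`, then `1 - s u` is invertible
for every `s ∈ [0, 1]`. -/
theorem isUnit_one_sub_smul_of_mem_unitaryGroup {u : Matrix n n ℂ} (hu : u ∈ unitaryGroup n ℂ)
    (h : IsUnit (1 - u)) {s : ℝ} (h0 : 0 ≤ s) : IsUnit (1 - s • u) := by
  have hu' : uᴴ * u = 1 := mem_unitaryGroup_iff'.1 hu
  have key : (1 - s • u)ᴴ * (1 - s • u) =
      (1 - s) ^ 2 • (1 : Matrix n n ℂ) + s • ((1 - u)ᴴ * (1 - u)) := by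
    simp only [conjTranspose_sub, conjTranspose_one, conjTranspose_smul, star_trivial, sub_mul,
      mul_sub, one_mul, mul_one, smul_mul_assoc, mul_smul_comm, hu']
    module
  have hpos : ((1 - s • u)ᴴ * (1 - s • u)).PosDef := by
    rw [key]
    rcases h0.eq_or_lt with rfl | hs
    · simpa using PosDef.one
    · exact PosDef.posSemidef_add (PosSemidef.one.smul (sq_nonneg _))
        ((PosDef.conjTranspose_mul_self _ (mulVec_injective_of_isUnit h)).smul hs)
  exact isUnit_of_mul_isUnit_right hpos.isUnit

/-- The Möbius transform `z ↦ (z - s) / (1 - s z)` preserves unitarity. -/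
theorem sub_mul_inv_mem_unitaryGroup {u : Matrix n n ℂ} (hu : u ∈ unitaryGroup n ℂ) {s : ℝ}
    (h : IsUnit (1 - s • u)) : (u - s • 1) * (1 - s • u)⁻¹ ∈ unitaryGroup n ℂ := by
  have hu' : uᴴ * u = 1 := mem_unitaryGroup_iff'.1 hu
  have key : (u - s • (1 : Matrix n n ℂ))ᴴ * (u - s • 1) = (1 - s • u)ᴴ * (1 - s • u) := by
    simp only [conjTranspose_sub, conjTranspose_one, conjTranspose_smul, star_trivial, sub_mul,
      mul_sub, one_mul, mul_one, smul_mul_assoc, mul_smul_comm, hu']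
    module
  have hinv : (1 - s • u) * (1 - s • u)⁻¹ = 1 :=
    mul_nonsing_inv _ ((isUnit_iff_isUnit_det _).1 h)
  rw [mem_unitaryGroup_iff', star_eq_conjTranspose]
  calc ((u - s • 1) * (1 - s • u)⁻¹)ᴴ * ((u - s • 1) * (1 - s • u)⁻¹)
      = (1 - s • u)⁻¹ᴴ * ((u - s • 1)ᴴ * (u - s • 1)) * (1 - s • u)⁻¹ := by
        simp only [conjTranspose_mul, Matrix.mul_assoc]
    _ = ((1 - s • u) * (1 - s • u)⁻¹)ᴴ * ((1 - s • u) * (1 - s • u)⁻¹) := by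
        simp only [key, conjTranspose_mul, Matrix.mul_assoc]
    _ = 1 := by simp [hinv]

variable {X : Type*} [TopologicalSpace X]

theorem _root_.Continuous.matrix_nonsing_inv {A : X → Matrix n n ℂ} (hA : Continuous A)
    (h : ∀ x, IsUnit (A x)) : Continuous fun x ↦ (A x)⁻¹ := by
  refine continuous_iff_continuousAt.2 fun x ↦
    (continuousAt_matrix_inv _ ?_).comp hA.continuousAt
  rw [Ring.inverse_eq_inv']
  exact continuousAt_inv₀ ((isUnit_iff_isUnit_det _).1 (h x)).ne_zero

/-- A family of unitary matrices without eigenvalue `1` is homotopic to the constant `-1`. -/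
theorem homotopic_neg_one_of_isUnit_one_sub (u : C(X, unitaryGroup n ℂ))
    (h : ∀ x, IsUnit (1 - (u x : Matrix n n ℂ))) :
    u.Homotopic (ContinuousMap.const X (-1)) := by
  have hunit (p : I × X) : IsUnit (1 - (p.1 : ℝ) • (u p.2 : Matrix n n ℂ)) :=
    isUnit_one_sub_smul_of_mem_unitaryGroup (u p.2).2 (h p.2) p.1.2.1
  refine ⟨⟨⟨fun p ↦ ⟨_, sub_mul_inv_mem_unitaryGroup (u p.2).2 (hunit p)⟩, ?_⟩, ?_, ?_⟩⟩
  · refine Continuous.subtype_mk (Continuous.mul (by fun_prop) ?_) _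
    exact Continuous.matrix_nonsing_inv (by fun_prop) hunit
  · intro x
    ext1
    simp
  · intro x
    refine Subtype.ext ?_
    change ((u x : Matrix n n ℂ) - (1 : ℝ) • 1) * (1 - (1 : ℝ) • (u x : Matrix n n ℂ))⁻¹ = -1
    rw [one_smul, one_smul, ← neg_sub, neg_mul,
      mul_nonsing_inv _ ((isUnit_iff_isUnit_det _).1 (h x))]

/-- Multiplying by `exp (π t i)` rotates `-1` to `1` inside the unitary group. -/
theorem homotopic_const_neg_one_one :
    (ContinuousMap.const X (-1 : unitaryGroup n ℂ)).Homotopic (ContinuousMap.const X 1) := by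
  have hmem (t : ℝ) : Complex.exp (t * Complex.I) • (1 : Matrix n n ℂ) ∈ unitaryGroup n ℂ := by
    rw [mem_unitaryGroup_iff']
    simp [star_smul, smul_smul, ← Complex.exp_conj, ← Complex.exp_add]
  refine ContinuousMap.Homotopic.symm
    ⟨⟨⟨fun p ↦ ⟨_, hmem (Real.pi * p.1)⟩, ?_⟩, ?_, ?_⟩⟩
  · exact Continuous.subtype_mk (by fun_prop) _
  · intro x
    ext1
    simp
  · intro x
    refine Subtype.ext ?_
    simp [Unitary.coe_neg]

end Matrix

/-- If `f, g : X → U(m)` are continuous maps into the unitary group such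
that for every `x`, `g(x)⁻¹ f(x) − I` is invertible (i.e. `1` is not an eigenvalue of
`g(x)⁻¹ f(x)`), then `f` and `g` are homotopic as maps into `U(m)`. -/
theorem homotopic_of_no_eigenvalue_one (m : ℕ) (hm : 1 ≤ m)
    (X : Type*) [TopologicalSpace X]
    (f g : C(X, Matrix.unitaryGroup (Fin m) ℂ))
    (h : ∀ x : X, IsUnit (((g x : Matrix (Fin m) (Fin m) ℂ))⁻¹ *
      (f x : Matrix (Fin m) (Fin m) ℂ) - 1)) :
    f.Homotopic g := by
  have hinv (x : X) : (g x : Matrix (Fin m) (Fin m) ℂ)⁻¹ = ((g x)⁻¹ : unitaryGroup (Fin m) ℂ) :=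
    inv_eq_left_inv (by simp)
  have hu : (g⁻¹ * f).Homotopic (ContinuousMap.const X 1) := by
    refine (homotopic_neg_one_of_isUnit_one_sub _ fun x ↦ ?_).trans homotopic_const_neg_one_one
    rw [← IsUnit.neg_iff, neg_sub]
    simpa only [hinv, ContinuousMap.mul_apply, ContinuousMap.inv_apply, UnitaryGroup.mul_val]
      using h x
  obtain ⟨H⟩ := hu
  exact ⟨⟨⟨fun p ↦ g p.2 * H p, by fun_prop⟩, fun x ↦ by simp, fun x ↦ by simp⟩⟩
end

section
/- Let (X₁,Y₁) and (X₂,Y₂) be Lagrangian frames of size m, let Λᵢ ⊆ ℂ^{2m} be the column span of the 2m×m matrix [Xᵢ;Yᵢ], and let Wᵢ = (Xᵢ+iYᵢ)(Xᵢ−iYᵢ)⁻¹ be the associated unitary matrices. Then dim_ℂ(Λ₁ ∩ Λ₂) = dim_ℂ ker(W₂⁻¹·W₁ − I_m). In particular, Λ₁ ∩ Λ₂ = {0} if and only if 1 is not an eigenvalue of W₂⁻¹·W₁. -/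
open Matrix

/-- For a symmetric pair, `X + cY` has the same Gram matrix as `[X; Y]` whenever `c` is a square
root of `-1` with `star c = -c`. -/
theorem conjTranspose_add_smul_mul_self {m : ℕ} {X Y : Matrix (Fin m) (Fin m) ℂ}
    (hsym : Xᴴ * Y = Yᴴ * X) {c : ℂ} (hc : star c = -c) (hcc : c * c = -1) :
    (X + c • Y)ᴴ * (X + c • Y) = (Matrix.fromRows X Y)ᴴ * Matrix.fromRows X Y := by
  rw [conjTranspose_fromRows_eq_fromCols_conjTranspose, fromCols_mul_fromRows,
    conjTranspose_add, conjTranspose_smul, hc]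
  have h : c • c • (Yᴴ * Y) = -(Yᴴ * Y) := by rw [smul_smul, hcc, neg_one_smul]
  simp only [add_mul, mul_add, smul_mul_assoc, mul_smul_comm, hsym, neg_smul, neg_mul,
    smul_add, smul_neg, h]
  abel

open scoped ComplexOrder in
theorem isUnit_add_smul_of_rank_fromRows {m : ℕ} {X Y : Matrix (Fin m) (Fin m) ℂ}
    (hsym : Xᴴ * Y = Yᴴ * X) (hrank : (Matrix.fromRows X Y).rank = m)
    {c : ℂ} (hc : star c = -c) (hcc : c * c = -1) : IsUnit (X + c • Y) := by
  have h : (X + c • Y).rank = m := by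
    rw [← rank_conjTranspose_mul_self, conjTranspose_add_smul_mul_self hsym hc hcc,
      rank_conjTranspose_mul_self, hrank]
  rw [← mulVec_surjective_iff_isUnit]
  have : LinearMap.range (X + c • Y).mulVecLin = ⊤ :=
    Submodule.eq_top_of_finrank_eq (by simpa [Matrix.rank] using h)
  exact LinearMap.range_eq_top.mp this

theorem isUnit_add_I_smul {m : ℕ} {X Y : Matrix (Fin m) (Fin m) ℂ}
    (hsym : Xᴴ * Y = Yᴴ * X) (hrank : (Matrix.fromRows X Y).rank = m) :
    IsUnit (X + Complex.I • Y) :=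
  isUnit_add_smul_of_rank_fromRows hsym hrank (by simp) (by simp)

theorem isUnit_sub_I_smul {m : ℕ} {X Y : Matrix (Fin m) (Fin m) ℂ}
    (hsym : Xᴴ * Y = Yᴴ * X) (hrank : (Matrix.fromRows X Y).rank = m) :
    IsUnit (X - Complex.I • Y) := by
  have := isUnit_add_smul_of_rank_fromRows hsym hrank (c := -Complex.I) (by simp) (by simp)
  rwa [neg_smul, ← sub_eq_add_neg] at this

/-- The span of `[X; Y]` is the graph of `(X + iY)(X - iY)⁻¹` in the coordinates `x ± iy`. -/
theorem mem_range_fromRows_iff {m : ℕ} {X Y : Matrix (Fin m) (Fin m) ℂ}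
    (hB : IsUnit (X - Complex.I • Y)) (x y : Fin m → ℂ) :
    Sum.elim x y ∈ LinearMap.range (Matrix.fromRows X Y).mulVecLin ↔
      x + Complex.I • y =
        ((X + Complex.I • Y) * (X - Complex.I • Y)⁻¹) *ᵥ (x - Complex.I • y) := by
  have hdet := (isUnit_iff_isUnit_det _).mp hB
  simp only [LinearMap.mem_range, mulVecLin_apply, fromRows_mulVec]
  constructor
  · rintro ⟨v, hv⟩
    obtain ⟨rfl, rfl⟩ := Sum.elim_eq_iff.mp hv
    rw [← smul_mulVec, ← sub_mulVec, ← add_mulVec, mulVec_mulVec, mul_assoc,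
      nonsing_inv_mul _ hdet, mul_one]
  · intro h
    set v := (X - Complex.I • Y)⁻¹ *ᵥ (x - Complex.I • y) with hv
    have h1 : X *ᵥ v + Complex.I • Y *ᵥ v = x + Complex.I • y := by
      rw [h, ← smul_mulVec, ← add_mulVec, hv, mulVec_mulVec]
    have h2 : X *ᵥ v - Complex.I • Y *ᵥ v = x - Complex.I • y := by
      rw [← smul_mulVec, ← sub_mulVec, hv, mulVec_mulVec, mul_nonsing_inv _ hdet, one_mulVec]
    refine ⟨v, Sum.elim_eq_iff.mpr ⟨?_, ?_⟩⟩ <;> ext i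
    · have e1 := congrFun h1 i
      have e2 := congrFun h2 i
      simp only [Pi.add_apply, Pi.sub_apply, Pi.smul_apply, smul_eq_mul] at e1 e2
      linear_combination (e1 + e2) / 2
    · have e1 := congrFun h1 i
      have e2 := congrFun h2 i
      simp only [Pi.add_apply, Pi.sub_apply, Pi.smul_apply, smul_eq_mul] at e1 e2
      refine mul_left_cancel₀ Complex.I_ne_zero ?_
      linear_combination (e1 - e2) / 2

theorem mem_ker_inv_mul_sub_one_iff {m : ℕ} {U V : Matrix (Fin m) (Fin m) ℂ} (hV : IsUnit V)
    (w : Fin m → ℂ) : w ∈ LinearMap.ker (V⁻¹ * U - 1).mulVecLin ↔ U *ᵥ w = V *ᵥ w := by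
  have hdet := (isUnit_iff_isUnit_det _).mp hV
  rw [LinearMap.mem_ker, mulVecLin_apply, sub_mulVec, one_mulVec, sub_eq_zero, ← mulVec_mulVec]
  constructor
  · intro h
    conv_rhs => rw [← h]
    rw [mulVec_mulVec, mul_nonsing_inv _ hdet, one_mulVec]
  · intro h
    rw [h, mulVec_mulVec, nonsing_inv_mul _ hdet, one_mulVec]

/-- The parametrization of the graph of `W` by the coordinate `w = x - iy`. -/
noncomputable def cayleyGraphMap {m : ℕ} (W : Matrix (Fin m) (Fin m) ℂ) :
    (Fin m → ℂ) →ₗ[ℂ] (Fin m ⊕ Fin m → ℂ) :=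
  (Matrix.fromRows ((1 / 2 : ℂ) • (W + 1)) ((-Complex.I / 2) • (W - 1))).mulVecLin

theorem cayleyGraphMap_apply {m : ℕ} (W : Matrix (Fin m) (Fin m) ℂ) (w : Fin m → ℂ) :
    cayleyGraphMap W w =
      Sum.elim ((1 / 2 : ℂ) • (W *ᵥ w + w)) ((-Complex.I / 2) • (W *ᵥ w - w)) := by
  simp [cayleyGraphMap, fromRows_mulVec, smul_mulVec, add_mulVec, sub_mulVec]

theorem cayley_add {m : ℕ} (u w : Fin m → ℂ) :
    (1 / 2 : ℂ) • (u + w) + Complex.I • (-Complex.I / 2) • (u - w) = u := by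
  ext i
  simp only [Pi.add_apply, Pi.sub_apply, Pi.smul_apply, smul_eq_mul]
  linear_combination (-(u i - w i) / 2) * Complex.I_mul_I

theorem cayley_sub {m : ℕ} (u w : Fin m → ℂ) :
    (1 / 2 : ℂ) • (u + w) - Complex.I • (-Complex.I / 2) • (u - w) = w := by
  ext i
  simp only [Pi.add_apply, Pi.sub_apply, Pi.smul_apply, smul_eq_mul]
  linear_combination ((u i - w i) / 2) * Complex.I_mul_I

theorem cayleyGraphMap_injective {m : ℕ} (W : Matrix (Fin m) (Fin m) ℂ) :
    Function.Injective (cayleyGraphMap W) := by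
  intro w w' h
  rw [cayleyGraphMap_apply, cayleyGraphMap_apply] at h
  obtain ⟨hx, hy⟩ := Sum.elim_eq_iff.mp h
  rw [← cayley_sub (W *ᵥ w) w, hx, hy, cayley_sub]

theorem cayleyGraphMap_sub {m : ℕ} {W : Matrix (Fin m) (Fin m) ℂ} {x y : Fin m → ℂ}
    (h : x + Complex.I • y = W *ᵥ (x - Complex.I • y)) :
    cayleyGraphMap W (x - Complex.I • y) = Sum.elim x y := by
  rw [cayleyGraphMap_apply, ← h]
  refine Sum.elim_eq_iff.mpr ⟨?_, ?_⟩ <;> ext i <;>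
    simp only [Pi.add_apply, Pi.sub_apply, Pi.smul_apply, smul_eq_mul]
  · ring
  · linear_combination (-y i) * Complex.I_mul_I

theorem range_inf_range_eq_map {m : ℕ} {X₁ Y₁ X₂ Y₂ W₁ W₂ : Matrix (Fin m) (Fin m) ℂ}
    (hB₁ : IsUnit (X₁ - Complex.I • Y₁)) (hB₂ : IsUnit (X₂ - Complex.I • Y₂))
    (hU₂ : IsUnit W₂)
    (hW₁ : W₁ = (X₁ + Complex.I • Y₁) * (X₁ - Complex.I • Y₁)⁻¹)
    (hW₂ : W₂ = (X₂ + Complex.I • Y₂) * (X₂ - Complex.I • Y₂)⁻¹) :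
    LinearMap.range (Matrix.fromRows X₁ Y₁).mulVecLin ⊓
        LinearMap.range (Matrix.fromRows X₂ Y₂).mulVecLin =
      (LinearMap.ker (W₂⁻¹ * W₁ - 1).mulVecLin).map (cayleyGraphMap W₁) := by
  ext z
  rw [Submodule.mem_inf, Submodule.mem_map]
  constructor
  · rw [← Sum.elim_comp_inl_inr z, mem_range_fromRows_iff hB₁, mem_range_fromRows_iff hB₂,
      ← hW₁, ← hW₂]
    rintro ⟨h₁, h₂⟩
    exact ⟨_, (mem_ker_inv_mul_sub_one_iff hU₂ _).mpr (h₁.symm.trans h₂), cayleyGraphMap_sub h₁⟩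
  · rintro ⟨w, hw, rfl⟩
    rw [mem_ker_inv_mul_sub_one_iff hU₂] at hw
    rw [cayleyGraphMap_apply, mem_range_fromRows_iff hB₁, mem_range_fromRows_iff hB₂,
      ← hW₁, ← hW₂, cayley_add, cayley_sub]
    exact ⟨rfl, hw⟩

/-- For Lagrangian frames `(X₁, Y₁)` and `(X₂, Y₂)` with column spans
`Λ₁, Λ₂ ⊆ ℂ^{2m}` and associated unitaries `W₁, W₂`, one has
`dim (Λ₁ ∩ Λ₂) = dim ker (W₂⁻¹ W₁ − I)`; in particular `Λ₁ ∩ Λ₂ = {0}` iff `1` is not an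
eigenvalue of `W₂⁻¹ W₁`. -/
theorem lagrangian_intersection_dim_eq (m : ℕ)
    (X₁ Y₁ X₂ Y₂ : Matrix (Fin m) (Fin m) ℂ)
    (hsym₁ : X₁ᴴ * Y₁ = Y₁ᴴ * X₁) (hrank₁ : (Matrix.fromRows X₁ Y₁).rank = m)
    (hsym₂ : X₂ᴴ * Y₂ = Y₂ᴴ * X₂) (hrank₂ : (Matrix.fromRows X₂ Y₂).rank = m)
    (W₁ W₂ : Matrix (Fin m) (Fin m) ℂ)
    (hW₁ : W₁ = (X₁ + Complex.I • Y₁) * (X₁ - Complex.I • Y₁)⁻¹)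
    (hW₂ : W₂ = (X₂ + Complex.I • Y₂) * (X₂ - Complex.I • Y₂)⁻¹) :
    Module.finrank ℂ
        ↥(LinearMap.range (Matrix.fromRows X₁ Y₁).mulVecLin ⊓
          LinearMap.range (Matrix.fromRows X₂ Y₂).mulVecLin) =
      Module.finrank ℂ (LinearMap.ker (W₂⁻¹ * W₁ - 1).mulVecLin) ∧
    ((LinearMap.range (Matrix.fromRows X₁ Y₁).mulVecLin ⊓
        LinearMap.range (Matrix.fromRows X₂ Y₂).mulVecLin) = ⊥ ↔
      IsUnit (W₂⁻¹ * W₁ - 1)) := by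
  have hB₁ := isUnit_sub_I_smul hsym₁ hrank₁
  have hB₂ := isUnit_sub_I_smul hsym₂ hrank₂
  have hU₂ : IsUnit W₂ := by
    rw [hW₂]
    exact (isUnit_add_I_smul hsym₂ hrank₂).mul (isUnit_nonsing_inv_iff.mpr hB₂)
  have hinj := cayleyGraphMap_injective W₁
  rw [range_inf_range_eq_map hB₁ hB₂ hU₂ hW₁ hW₂]
  refine ⟨(Submodule.equivMapOfInjective _ hinj _).finrank_eq.symm, ?_⟩
  rw [(Submodule.map_injective_of_injective hinj).eq_iff' (Submodule.map_bot _),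
    LinearMap.ker_eq_bot, ← mulVec_injective_iff_isUnit]
  rfl
end
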